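/- Let α, β ≥ 1 be integers with gcd(α,β) = 1 and let r, t be nonzero real numbers with r² + t² = 1. Define the Floquet matrix Û(θ) = [[r²·exp(2πi(β−α)θ) + t²·exp(−2πi α θ), r t·exp(2πi(β−α)θ) − r t·exp(−2πi α θ)],[r t·exp(2πi β θ) − r t, r² + t²·exp(2πi β θ)]] for θ ∈ ℝ (the Floquet matrix of the split-step quantum walk with step sizes α, β). Then the spectral NRG condition holds: max over m ∈ {1,…,N−1} of N^{−1}·#{q ∈ {0,…,N−1} : spectrum(Û((q+m)/N)) ∩ spectrum(Û(q/N)) ≠ ∅} tends to 0 as N → ∞. -/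

import Mathlib

open Filter

noncomputable section

namespace QW1

/-- Spectral "No Repeating Graphs" condition in dimension one. -/
def SpectralNRG {ι : Type*} [Fintype ι] [DecidableEq ι] (U : ℝ → Matrix ι ι ℂ) : Prop :=
  ∀ ε : ℝ, 0 < ε → ∃ N₀ : ℕ, ∀ N : ℕ, N₀ ≤ N → ∀ m : ℕ, 1 ≤ m → m < N →
    ((Set.ncard {q : Fin N |
      (spectrum ℂ (U ((((q : ℕ) + m : ℕ) : ℝ) / (N : ℝ))) ∩
       spectrum ℂ (U (((q : ℕ) : ℝ) / (N : ℝ)))).Nonempty}) : ℝ) / (N : ℝ) < ε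

/-- The quantum walk matrix written in terms of `x = z ^ α` and `y = z ^ β`. -/
def walkMatrix (r t x y : ℂ) : Matrix (Fin 2) (Fin 2) ℂ :=
  !![r ^ 2 * (y / x) + t ^ 2 * x⁻¹, r * t * (y / x) - r * t * x⁻¹;
     r * t * y - r * t, r ^ 2 + t ^ 2 * y]

lemma char_eq_of_mem_spectrum {r t x y l : ℂ} (hrt : r ^ 2 + t ^ 2 = 1) (hx : x ≠ 0)
    (h : l ∈ spectrum ℂ (walkMatrix r t x y)) :
    x * l ^ 2 - (r ^ 2 * (x + y) + t ^ 2 * (1 + x * y)) * l + y = 0 := by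
  rw [Matrix.mem_spectrum_iff_isRoot_charpoly, Matrix.charpoly_fin_two] at h
  simp only [walkMatrix, Matrix.trace_fin_two_of, Matrix.det_fin_two_of, Polynomial.IsRoot.def,
    Polynomial.eval_add, Polynomial.eval_sub, Polynomial.eval_mul, Polynomial.eval_pow,
    Polynomial.eval_X, Polynomial.eval_C] at h
  field_simp at h
  linear_combination h - y * (r ^ 2 + t ^ 2 + 1) * hrt

/-- Two quadratics with a common nonzero root have vanishing resultant. -/
lemma resultant_eq_zero_of_common_root {x y a b B B' l : ℂ} (hy : y ≠ 0)
    (h : x * l ^ 2 - B * l + y = 0) (h' : a * x * l ^ 2 - B' * l + b * y = 0) :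
    (B' - a * B) * (b * B - B') - (b - a) ^ 2 * (x * y) = 0 := by
  have hl : l ≠ 0 := by
    rintro rfl
    exact hy (by linear_combination h)
  have h₁ : (B' - a * B) * l = (b - a) * y := by linear_combination a * h - h'
  have h₂ : (b - a) * x * l = b * B - B' :=
    mul_right_cancel₀ hl (by linear_combination b * h - h')
  linear_combination (a * B - B') * h₂ + (b - a) * x * h₁

open Polynomial in
/-- Up to sign and monomial factors, the resultant of the characteristic polynomials of `walkMatrix`
at `z` and at `w * z`, as a polynomial in `z`, where `a = w ^ α` and `b = w ^ β`. -/
def resultantPoly (r t a b : ℂ) (α β : ℕ) : ℂ[X] :=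
  (C (r ^ 2 * (b - a)) * X ^ β + C (t ^ 2 * (1 - a)) + C (t ^ 2 * a * (b - 1)) * X ^ (α + β)) *
    (C (r ^ 2 * (b - a)) * X ^ α + C (t ^ 2 * (b - 1)) + C (t ^ 2 * b * (1 - a)) * X ^ (α + β)) -
    C ((b - a) ^ 2) * X ^ (α + β)

lemma eval_resultantPoly (r t a b z : ℂ) (α β : ℕ) :
    (resultantPoly r t a b α β).eval z =
      (r ^ 2 * (b - a) * z ^ β + t ^ 2 * (1 - a) + t ^ 2 * a * (b - 1) * (z ^ α * z ^ β)) *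
        (r ^ 2 * (b - a) * z ^ α + t ^ 2 * (b - 1) + t ^ 2 * b * (1 - a) * (z ^ α * z ^ β)) -
      (b - a) ^ 2 * (z ^ α * z ^ β) := by
  simp [resultantPoly, pow_add]

lemma natDegree_resultantPoly_le (r t a b : ℂ) (α β : ℕ) :
    (resultantPoly r t a b α β).natDegree ≤ 2 * (α + β) := by
  unfold resultantPoly
  compute_degree
  all_goals omega

lemma two_pow_sub_one_ne_zero {n : ℕ} (hn : 1 ≤ n) : (2 : ℂ) ^ n - 1 ≠ 0 := by
  have h : (2 : ℕ) ^ n ≠ 1 := (Nat.one_lt_two_pow (by omega)).ne'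
  exact sub_ne_zero.mpr (by exact_mod_cast h)

lemma resultantPoly_ne_zero {r t a b : ℂ} {α β : ℕ} (hα : 1 ≤ α) (hβ : 1 ≤ β)
    (hr : r ≠ 0) (ht : t ≠ 0) (hrt : r ^ 2 + t ^ 2 = 1) (hab : ¬(a = 1 ∧ b = 1)) :
    resultantPoly r t a b α β ≠ 0 := by
  intro h
  have hev (z : ℂ) := (eval_resultantPoly r t a b z α β).symm.trans
    (by rw [h, Polynomial.eval_zero])
  have hr2 : r ^ 2 = 1 - t ^ 2 := by linear_combination hrt
  by_cases ha : a = 1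
  · subst ha
    have hb : b - 1 ≠ 0 := sub_ne_zero.mpr fun hb => hab ⟨rfl, hb⟩
    have key : (b - 1) ^ 2 * 2 ^ β * r ^ 2 * t ^ 2 * ((2 : ℂ) ^ α - 1) ^ 2 = 0 := by
      have := hev 2
      rw [hr2] at this ⊢
      linear_combination this
    simp [hb, hr, ht, two_pow_sub_one_ne_zero hα] at key
  · have ha' : 1 - a ≠ 0 := sub_ne_zero.mpr (Ne.symm ha)
    by_cases hb : b = 1
    · subst hb
      have key : (1 - a) ^ 2 * 2 ^ α * r ^ 2 * t ^ 2 * ((2 : ℂ) ^ β - 1) ^ 2 = 0 := by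
        have := hev 2
        rw [hr2] at this ⊢
        linear_combination this
      simp [ha', hr, ht, two_pow_sub_one_ne_zero hβ] at key
    · have := hev 0
      simp [zero_pow (by omega : α ≠ 0), zero_pow (by omega : β ≠ 0), ht, ha',
        sub_ne_zero.mpr hb] at this

lemma isRoot_resultantPoly {r t w z : ℂ} {α β : ℕ} (hrt : r ^ 2 + t ^ 2 = 1)
    (hw : w ≠ 0) (hz : z ≠ 0)
    (h : (spectrum ℂ (walkMatrix r t ((w * z) ^ α) ((w * z) ^ β)) ∩
      spectrum ℂ (walkMatrix r t (z ^ α) (z ^ β))).Nonempty) :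
    (resultantPoly r t (w ^ α) (w ^ β) α β).IsRoot z := by
  obtain ⟨l, hl', hl⟩ := h
  have e := char_eq_of_mem_spectrum hrt (pow_ne_zero α hz) hl
  have e' := char_eq_of_mem_spectrum hrt (pow_ne_zero α (mul_ne_zero hw hz)) hl'
  rw [mul_pow, mul_pow] at e'
  have := resultant_eq_zero_of_common_root (pow_ne_zero β hz) e e'
  rw [Polynomial.IsRoot.def, eval_resultantPoly]
  linear_combination this

lemma exp_natCast_div (N k j : ℕ) :
    Complex.exp (2 * Real.pi * Complex.I * (((j : ℝ) * ((k : ℝ) / (N : ℝ)) : ℝ) : ℂ)) =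
      (Complex.exp (2 * Real.pi * Complex.I / N) ^ k) ^ j := by
  rw [← Complex.exp_nat_mul, ← Complex.exp_nat_mul]
  congr 1
  push_cast
  ring

lemma floquet_eq_walkMatrix (r t : ℝ) (α β N k : ℕ) :
    (!![(r ^ 2 : ℂ) * Complex.exp (2 * Real.pi * Complex.I * ((((β : ℝ) - (α : ℝ)) * ((k : ℝ) / (N : ℝ)) : ℝ) : ℂ))
            + (t ^ 2 : ℂ) * Complex.exp (-(2 * Real.pi * Complex.I) * (((α : ℝ) * ((k : ℝ) / (N : ℝ)) : ℝ) : ℂ)),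
          (r * t : ℂ) * Complex.exp (2 * Real.pi * Complex.I * ((((β : ℝ) - (α : ℝ)) * ((k : ℝ) / (N : ℝ)) : ℝ) : ℂ))
            - (r * t : ℂ) * Complex.exp (-(2 * Real.pi * Complex.I) * (((α : ℝ) * ((k : ℝ) / (N : ℝ)) : ℝ) : ℂ));
          (r * t : ℂ) * Complex.exp (2 * Real.pi * Complex.I * (((β : ℝ) * ((k : ℝ) / (N : ℝ)) : ℝ) : ℂ))
            - (r * t : ℂ),
          (r ^ 2 : ℂ)
            + (t ^ 2 : ℂ) * Complex.exp (2 * Real.pi * Complex.I * (((β : ℝ) * ((k : ℝ) / (N : ℝ)) : ℝ) : ℂ))] :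
        Matrix (Fin 2) (Fin 2) ℂ) =
      walkMatrix r t ((Complex.exp (2 * Real.pi * Complex.I / N) ^ k) ^ α)
        ((Complex.exp (2 * Real.pi * Complex.I / N) ^ k) ^ β) := by
  rw [sub_mul, Complex.ofReal_sub, mul_sub, Complex.exp_sub, neg_mul, Complex.exp_neg,
    exp_natCast_div, exp_natCast_div, walkMatrix]

/-- **NRG for split-step walks with coprime step sizes.** If `r, t ≠ 0`, `r² + t² = 1`
and `gcd(α,β) = 1`, the Floquet matrix of the split-step walk with step sizes `α, β`
satisfies the spectral NRG condition. -/
theorem split_step_NRG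
    (α β : ℕ) (hα : 1 ≤ α) (hβ : 1 ≤ β) (hgcd : Nat.gcd α β = 1)
    (r t : ℝ) (hr : r ≠ 0) (ht : t ≠ 0) (hrt : r ^ 2 + t ^ 2 = 1) :
    SpectralNRG (fun θ : ℝ =>
      (!![(r ^ 2 : ℂ) * Complex.exp (2 * Real.pi * Complex.I * ((((β : ℝ) - (α : ℝ)) * θ : ℝ) : ℂ))
            + (t ^ 2 : ℂ) * Complex.exp (-(2 * Real.pi * Complex.I) * (((α : ℝ) * θ : ℝ) : ℂ)),
          (r * t : ℂ) * Complex.exp (2 * Real.pi * Complex.I * ((((β : ℝ) - (α : ℝ)) * θ : ℝ) : ℂ))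
            - (r * t : ℂ) * Complex.exp (-(2 * Real.pi * Complex.I) * (((α : ℝ) * θ : ℝ) : ℂ));
          (r * t : ℂ) * Complex.exp (2 * Real.pi * Complex.I * (((β : ℝ) * θ : ℝ) : ℂ))
            - (r * t : ℂ),
          (r ^ 2 : ℂ)
            + (t ^ 2 : ℂ) * Complex.exp (2 * Real.pi * Complex.I * (((β : ℝ) * θ : ℝ) : ℂ))] :
        Matrix (Fin 2) (Fin 2) ℂ)) := by
  intro ε hε
  obtain ⟨n, hn⟩ := exists_nat_gt (((2 * (α + β) : ℕ) : ℝ) / ε)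
  refine ⟨n, fun N hN m hm hmN => ?_⟩
  simp only [floquet_eq_walkMatrix]
  have hN0 : N ≠ 0 := by omega
  have hrt' : (r : ℂ) ^ 2 + (t : ℂ) ^ 2 = 1 := by exact_mod_cast hrt
  set ζ := Complex.exp (2 * Real.pi * Complex.I / N)
  have hprim : IsPrimitiveRoot ζ N := Complex.isPrimitiveRoot_exp N hN0
  have hζ0 : ζ ≠ 0 := Complex.exp_ne_zero _
  have hab : ¬((ζ ^ m) ^ α = 1 ∧ (ζ ^ m) ^ β = 1) := by
    rintro ⟨h₁, h₂⟩
    have h := Nat.dvd_gcd (orderOf_dvd_of_pow_eq_one h₁) (orderOf_dvd_of_pow_eq_one h₂)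
    rw [hgcd, Nat.dvd_one, orderOf_eq_one_iff] at h
    exact hprim.pow_ne_one_of_pos_of_lt (by omega) hmN h
  set P := resultantPoly r t ((ζ ^ m) ^ α) ((ζ ^ m) ^ β) α β
  have hP0 : P ≠ 0 := resultantPoly_ne_zero hα hβ (by exact_mod_cast hr) (by exact_mod_cast ht)
    hrt' hab
  have hcard := Set.ncard_le_ncard_of_injOn (s := {q : Fin N |
      (spectrum ℂ (walkMatrix r t ((ζ ^ ((q : ℕ) + m)) ^ α) ((ζ ^ ((q : ℕ) + m)) ^ β)) ∩
        spectrum ℂ (walkMatrix r t ((ζ ^ (q : ℕ)) ^ α) ((ζ ^ (q : ℕ)) ^ β))).Nonempty})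
    (t := ↑P.roots.toFinset) (fun q : Fin N => ζ ^ (q : ℕ))
    (fun q hq => by
      rw [Set.mem_ofPred_eq, add_comm, pow_add] at hq
      simpa [hP0] using isRoot_resultantPoly hrt' (pow_ne_zero m hζ0) (pow_ne_zero q hζ0) hq)
    (fun q _ q' _ h => Fin.ext (hprim.pow_inj q.2 q'.2 h)) (Finset.finite_toSet _)
  rw [Set.ncard_coe_finset] at hcard
  have hbound := hcard.trans ((Multiset.toFinset_card_le _).trans
    ((Polynomial.card_roots' P).trans (natDegree_resultantPoly_le _ _ _ _ α β)))
  have hNpos : (0 : ℝ) < N := by positivity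
  rw [div_lt_iff₀ hNpos]
  rw [div_lt_iff₀ hε] at hn
  calc _ ≤ ((2 * (α + β) : ℕ) : ℝ) := Nat.cast_le.mpr hbound
    _ < n * ε := hn
    _ ≤ N * ε := by gcongr
    _ = ε * N := mul_comm _ _

end QW1
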